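/- Let μ = e^{−Φ} L^{2N} × H^N⌞E on Z × Z, where Φ : Z → ℝ is Borel and satisfies the sub-Gaussian transversality condition β₀‖y − z‖² + Φ(y) ≥ c(‖y‖² + ‖z‖²) − b for all y ∈ Z, z ∈ E, with constants β₀, c, b > 0. Then the family {μ_β : β ≥ 2β₀} of thermalizations is uniformly tight: for every ε > 0 there exists a compact set K ⊆ Z × Z such that μ_β((Z × Z) \ K) < ε for all β ≥ 2β₀. -/

import Mathlib

open MeasureTheory Real Filter Topology

noncomputable section

/-- Phase space `Z`, identified with `ℝ^{2N}` (with Lebesgue measure `volume`). -/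
abbrev ZZ (N : ℕ) := EuclideanSpace ℝ (Fin (2 * N))

/-- The normalization constant `B_β = ∫_Z exp(−β‖ξ‖²) dL^{2N}(ξ)`. -/
def Bconst (N : ℕ) (β : ℝ) : ℝ := ∫ ξ : ZZ N, Real.exp (-β * ‖ξ‖ ^ 2)

/-- The thermalization `μ_β := w_β · μ` with `w_β(y,z) = B_β⁻¹ exp(−β‖y−z‖²)`. -/
def therm {N : ℕ} (μ : Measure (ZZ N × ZZ N)) (β : ℝ) : Measure (ZZ N × ZZ N) :=
  μ.withDensity fun q => ENNReal.ofReal ((Bconst N β)⁻¹ * Real.exp (-β * ‖q.1 - q.2‖ ^ 2))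

/-- The deterministic physical likelihood `μ_E = H^N ⌞ E`. -/
def muE (N : ℕ) (E : AffineSubspace ℝ (ZZ N)) : Measure (ZZ N) :=
  (μH[(N : ℝ)]).restrict (E : Set (ZZ N))

/-- The sub-Gaussian material likelihood `μ_D = e^{−Φ} L^{2N}`. -/
def muD (N : ℕ) (Φ : ZZ N → ℝ) : Measure (ZZ N) :=
  volume.withDensity fun y => ENNReal.ofReal (Real.exp (-Φ y))

/-- A real Gaussian is integrable for any Haar measure on a Euclidean space. -/
theorem lintegral_gaussian_lt_top {V : Type*} [NormedAddCommGroup V] [InnerProductSpace ℝ V]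
    [FiniteDimensional ℝ V] [MeasurableSpace V] [BorelSpace V]
    (ν : Measure V) [ν.IsAddHaarMeasure] {a : ℝ} (ha : 0 < a) :
    ∫⁻ v, ENNReal.ofReal (Real.exp (-a * ‖v‖ ^ 2)) ∂ν < ⊤ := by
  have hint : Integrable (fun v : V => Real.exp (-a * ‖v‖ ^ 2)) := by
    refine not_imp_comm.1 integral_undef ?_
    rw [GaussianFourier.integral_rexp_neg_mul_sq_norm ha]
    positivity
  rw [Measure.isAddLeftInvariant_eq_smul ν volume, lintegral_smul_measure]
  exact ENNReal.mul_lt_top ENNReal.coe_lt_top hint.lintegral_lt_top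

/-- The measure `H^N ⌞ E` is the push-forward of the Hausdorff measure of the direction of `E`
under translation by a point of `E`. -/
theorem muE_eq_map {N : ℕ} {E : AffineSubspace ℝ (ZZ N)} {p : ZZ N} (hp : p ∈ E) :
    muE N E = (μH[(N : ℝ)] : Measure E.direction).map fun v : E.direction => (v : ZZ N) + p := by
  have hf : Isometry fun v : E.direction => (v : ZZ N) + p :=
    Isometry.of_dist_eq fun v w => by simp [Subtype.dist_eq]
  rw [hf.map_hausdorffMeasure (Or.inl N.cast_nonneg), muE]
  congr 1
  ext z
  constructor
  · intro hz
    exact ⟨⟨z - p, E.vsub_mem_direction hz hp⟩, by simp⟩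
  · rintro ⟨v, rfl⟩
    exact E.vadd_mem_of_mem_direction v.2 hp

theorem sFinite_muE {N : ℕ} {E : AffineSubspace ℝ (ZZ N)} (hE : (E : Set (ZZ N)).Nonempty)
    (hdim : Module.finrank ℝ E.direction = N) : SFinite (muE N E) := by
  obtain ⟨p, hp⟩ := hE
  have : (μH[(N : ℝ)] : Measure E.direction).IsAddHaarMeasure := by
    simpa only [hdim] using isAddHaarMeasure_hausdorffMeasure (E := E.direction)
  rw [muE_eq_map hp]
  infer_instance

theorem lintegral_gaussian_muE_lt_top {N : ℕ} {E : AffineSubspace ℝ (ZZ N)}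
    (hE : (E : Set (ZZ N)).Nonempty) (hdim : Module.finrank ℝ E.direction = N)
    {a : ℝ} (ha : 0 < a) :
    ∫⁻ z, ENNReal.ofReal (Real.exp (-a * ‖z‖ ^ 2)) ∂muE N E < ⊤ := by
  obtain ⟨p, hp⟩ := hE
  have : (μH[(N : ℝ)] : Measure E.direction).IsAddHaarMeasure := by
    simpa only [hdim] using isAddHaarMeasure_hausdorffMeasure (E := E.direction)
  rw [muE_eq_map hp, lintegral_map (by fun_prop) (by fun_prop)]
  calc ∫⁻ v : E.direction, ENNReal.ofReal (Real.exp (-a * ‖(v : ZZ N) + p‖ ^ 2)) ∂μH[(N : ℝ)]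
      ≤ ∫⁻ v : E.direction, ENNReal.ofReal (Real.exp (a * ‖p‖ ^ 2)) *
          ENNReal.ofReal (Real.exp (-(a / 2) * ‖v‖ ^ 2)) ∂μH[(N : ℝ)] := by
        refine lintegral_mono fun v => ?_
        rw [← ENNReal.ofReal_mul (Real.exp_nonneg _), ← Real.exp_add]
        refine ENNReal.ofReal_le_ofReal (Real.exp_le_exp.2 ?_)
        have h : ‖v‖ ≤ ‖(v : ZZ N) + p‖ + ‖p‖ := by
          simpa using norm_sub_le ((v : ZZ N) + p) p
        have h2 : ‖v‖ ^ 2 ≤ 2 * (‖(v : ZZ N) + p‖ ^ 2 + ‖p‖ ^ 2) := by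
          nlinarith [norm_nonneg v, sq_nonneg (‖(v : ZZ N) + p‖ - ‖p‖)]
        nlinarith
    _ < ⊤ := by
        rw [lintegral_const_mul _ (by fun_prop)]
        exact ENNReal.mul_lt_top ENNReal.ofReal_lt_top
          (lintegral_gaussian_lt_top _ (half_pos ha))

theorem Bconst_eq (N : ℕ) {β : ℝ} (hβ : 0 < β) : Bconst N β = (π / β) ^ N := by
  rw [Bconst, GaussianFourier.integral_rexp_neg_mul_sq_norm hβ, finrank_euclideanSpace_fin]
  push_cast
  rw [mul_div_cancel_left₀ _ two_ne_zero, Real.rpow_natCast]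

/-- Normalizing with `B_β` a Gaussian of half the inverse temperature costs a factor `2 ^ N`. -/
theorem lintegral_Bconst_inv_mul_exp (N : ℕ) {β : ℝ} (hβ : 0 < β) (z : ZZ N) :
    ∫⁻ y : ZZ N, ENNReal.ofReal ((Bconst N β)⁻¹ * Real.exp (-(β / 2) * ‖y - z‖ ^ 2)) =
      ENNReal.ofReal (2 ^ N) := by
  rw [lintegral_sub_right_eq_self
    (fun y : ZZ N => ENNReal.ofReal ((Bconst N β)⁻¹ * Real.exp (-(β / 2) * ‖y‖ ^ 2))) z]
  have hval : ∫ y : ZZ N, Real.exp (-(β / 2) * ‖y‖ ^ 2) = (π / (β / 2)) ^ N :=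
    Bconst_eq N (half_pos hβ)
  have hint : Integrable (fun y : ZZ N => Real.exp (-(β / 2) * ‖y‖ ^ 2)) := by
    refine not_imp_comm.1 integral_undef ?_
    rw [hval]
    positivity
  have hB : 0 ≤ (Bconst N β)⁻¹ := by
    rw [Bconst_eq N hβ]
    positivity
  rw [← ofReal_integral_eq_lintegral_ofReal (hint.const_mul _)
    (Eventually.of_forall fun y => mul_nonneg hB (Real.exp_nonneg _)),
    integral_const_mul, hval, Bconst_eq N hβ, ← inv_pow, ← mul_pow]
  congr 2
  field_simp

/-- Uniform tail bound for the thermalizations outside a ball of the product space. -/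
theorem therm_compl_closedBall_le {N : ℕ} {E : AffineSubspace ℝ (ZZ N)}
    (hE : (E : Set (ZZ N)).Nonempty) (hdim : Module.finrank ℝ E.direction = N)
    {Φ : ZZ N → ℝ} (hΦ : Measurable Φ) {β₀ c b : ℝ} (hβ₀ : 0 < β₀) (hc : 0 < c)
    (htrans : ∀ y : ZZ N, ∀ z ∈ E, c * (‖y‖ ^ 2 + ‖z‖ ^ 2) - b ≤ β₀ * ‖y - z‖ ^ 2 + Φ y)
    {R : ℝ} (hR : 0 ≤ R) {β : ℝ} (hβ : 2 * β₀ ≤ β) :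
    therm ((muD N Φ).prod (muE N E)) β (Metric.closedBall 0 R)ᶜ ≤
      ENNReal.ofReal (Real.exp (b - c / 2 * R ^ 2)) * (ENNReal.ofReal (2 ^ N) *
        ∫⁻ z, ENNReal.ofReal (Real.exp (-(c / 2) * ‖z‖ ^ 2)) ∂muE N E) := by
  have := sFinite_muE hE hdim
  have hβpos : 0 < β := by linarith
  have hB : 0 ≤ (Bconst N β)⁻¹ := by
    rw [Bconst_eq N hβpos]
    positivity
  have hball : MeasurableSet (Metric.closedBall (0 : ZZ N × ZZ N) R)ᶜ :=
    Metric.isClosed_closedBall.measurableSet.compl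
  have hmem : ∀ᵐ q ∂(volume : Measure (ZZ N)).prod (muE N E), q.2 ∈ E :=
    Measure.quasiMeasurePreserving_snd.ae
      (ae_restrict_mem E.closed_of_finiteDimensional.measurableSet)
  rw [therm, muD, prod_withDensity_left (by fun_prop),
    ← withDensity_mul _ (by fun_prop) (by fun_prop), withDensity_apply _ hball]
  calc _ ≤ ∫⁻ q in (Metric.closedBall (0 : ZZ N × ZZ N) R)ᶜ,
          ENNReal.ofReal (Real.exp (b - c / 2 * R ^ 2)) *
          (ENNReal.ofReal ((Bconst N β)⁻¹ * Real.exp (-(β / 2) * ‖q.1 - q.2‖ ^ 2)) *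
            ENNReal.ofReal (Real.exp (-(c / 2) * ‖q.2‖ ^ 2)))
          ∂(volume : Measure (ZZ N)).prod (muE N E) := by
        refine lintegral_mono_ae ?_
        filter_upwards [ae_restrict_mem hball, ae_restrict_of_ae hmem] with q hq hqE
        have hnorm : R ^ 2 ≤ ‖q.1‖ ^ 2 + ‖q.2‖ ^ 2 := by
          have hlt : R < max ‖q.1‖ ‖q.2‖ := by
            rwa [Set.mem_compl_iff, mem_closedBall_zero_iff, not_le, Prod.norm_def] at hq
          rcases lt_max_iff.1 hlt with h | h <;>
            nlinarith [sq_nonneg ‖q.1‖, sq_nonneg ‖q.2‖]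
        simp only [Pi.mul_apply]
        rw [← ENNReal.ofReal_mul (Real.exp_nonneg _),
          ← ENNReal.ofReal_mul (mul_nonneg hB (Real.exp_nonneg _)),
          ← ENNReal.ofReal_mul (Real.exp_nonneg _)]
        refine ENNReal.ofReal_le_ofReal ?_
        rw [mul_left_comm, mul_assoc, mul_left_comm (Real.exp (b - _)), ← Real.exp_add,
          ← Real.exp_add, ← Real.exp_add]
        refine mul_le_mul_of_nonneg_left (Real.exp_le_exp.2 ?_) hB
        have h1 := htrans q.1 q.2 hqE
        have h2 := mul_le_mul_of_nonneg_left hnorm hc.le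
        nlinarith [mul_nonneg (sub_nonneg.2 hβ) (sq_nonneg ‖q.1 - q.2‖),
          mul_nonneg hc.le (sq_nonneg ‖q.1‖)]
    _ ≤ _ := setLIntegral_le_lintegral _ _
    _ = _ := by
        rw [lintegral_const_mul _ (by fun_prop), lintegral_prod_symm' _ (by fun_prop)]
        congr 1
        rw [← lintegral_const_mul _ (by fun_prop)]
        refine lintegral_congr fun z => ?_
        dsimp only
        rw [lintegral_mul_const _ (by fun_prop), lintegral_Bconst_inv_mul_exp N hβpos z]

/-!
STATEMENT 3: For `μ = e^{−Φ} L^{2N} × H^N⌞E` with `Φ` Borel satisfying the sub-Gaussian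
transversality condition, the family `{μ_β : β ≥ 2β₀}` of thermalizations is uniformly
tight: for every `ε > 0` there is a compact `K ⊆ Z × Z` with `μ_β((Z×Z) \ K) < ε`
for all `β ≥ 2β₀`.
-/

theorem subGaussian_uniformly_tight
    (N : ℕ) (E : AffineSubspace ℝ (ZZ N)) (hE : (E : Set (ZZ N)).Nonempty)
    (hdim : Module.finrank ℝ E.direction = N)
    (Φ : ZZ N → ℝ) (hΦ : Measurable Φ)
    (β₀ c b : ℝ) (hβ₀ : 0 < β₀) (hc : 0 < c) (hb : 0 < b)
    (htrans : ∀ y : ZZ N, ∀ z ∈ E, c * (‖y‖ ^ 2 + ‖z‖ ^ 2) - b ≤ β₀ * ‖y - z‖ ^ 2 + Φ y) :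
    ∀ ε : ℝ, 0 < ε → ∃ K : Set (ZZ N × ZZ N), IsCompact K ∧
      ∀ β : ℝ, 2 * β₀ ≤ β →
        (therm ((muD N Φ).prod (muE N E)) β) Kᶜ < ENNReal.ofReal ε := by
  intro ε hε
  set D : ENNReal := ENNReal.ofReal (2 ^ N) *
    ∫⁻ z, ENNReal.ofReal (Real.exp (-(c / 2) * ‖z‖ ^ 2)) ∂muE N E
  have hDtop : D ≠ ⊤ := (ENNReal.mul_lt_top ENNReal.ofReal_lt_top
    (lintegral_gaussian_muE_lt_top hE hdim (half_pos hc))).ne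
  have hexp : Tendsto (fun R : ℝ => Real.exp (b - c / 2 * R ^ 2)) atTop (𝓝 0) := by
    refine Real.tendsto_exp_atBot.comp (tendsto_atBot_add_const_left _ b ?_)
    exact tendsto_neg_atTop_atBot.comp
      ((tendsto_pow_atTop two_ne_zero).const_mul_atTop (half_pos hc))
  have hlim : Tendsto (fun R : ℝ => ENNReal.ofReal (Real.exp (b - c / 2 * R ^ 2)) * D)
      atTop (𝓝 0) := by
    simpa using ENNReal.Tendsto.mul_const (ENNReal.tendsto_ofReal hexp) (Or.inr hDtop)
  obtain ⟨R, hRε, hR⟩ := ((hlim.eventually_lt_const (ENNReal.ofReal_pos.2 hε)).and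
    (eventually_ge_atTop 0)).exists
  exact ⟨Metric.closedBall 0 R, isCompact_closedBall _ _, fun β hβ =>
    (therm_compl_closedBall_le hE hdim hΦ hβ₀ hc htrans hR hβ).trans_lt hRε⟩
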